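/- arXiv:2207.04629 — 2 statements merged into one kernel-verified Lean document; each statement's English description precedes it below -/
import Mathlib

section
/- Let q = p^e be an odd prime power and let τ, μ ∈ F_q with τ ≠ 0. Then for all X, Y ∈ G one has N_{τ,μ}(X·Y) = N_{τ,μ}(X)·N_{τ,μ}(Y); that is, N_{τ,μ} is a q-dimensional complex matrix representation of the group G. -/
/-- Quintuples over `F`, the underlying set of the group `G = (F_q^5, ·)`. -/
abbrev Tup (F : Type) : Type := F × F × F × F × F

/-- The group operation
`X·Y = (x₁+y₁, x₂+y₂, x₃+y₃, x₄+y₄+2x₁y₂, x₅+y₅+2x₁y₃)` of `G`. -/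
def gmul {F : Type} [Field F] (X Y : Tup F) : Tup F :=
  (X.1 + Y.1, X.2.1 + Y.2.1, X.2.2.1 + Y.2.2.1,
   X.2.2.2.1 + Y.2.2.2.1 + 2 * X.1 * Y.2.1,
   X.2.2.2.2 + Y.2.2.2.2 + 2 * X.1 * Y.2.2.1)

/-- `zetaTr p F c = ζ^{tr(c)} = e^{2πi·tr(c)/p}`, where `tr : F_q → F_p` is the absolute trace. -/
noncomputable def zetaTr (p : ℕ) (F : Type) [Field F] [Fintype F] [Algebra (ZMod p) F]
    (c : F) : ℂ :=
  Complex.exp (2 * Real.pi * Complex.I * ((Algebra.trace (ZMod p) F c).val : ℂ) / (p : ℂ))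

/-- The `q×q` complex matrix `N_{τ,μ}(X)`, indexed by `F_q`, whose `(j,k)` entry is
`ζ^{tr(x₃·j + τ·x₅ + μ·x₂)}` if `k = 2x₁τ + j`, and `0` otherwise. -/
noncomputable def Nrep (p : ℕ) (F : Type) [Field F] [Fintype F] [DecidableEq F]
    [Algebra (ZMod p) F] (τ μ : F) (X : Tup F) : Matrix F F ℂ :=
  Matrix.of fun j k =>
    if k = 2 * X.1 * τ + j then
      zetaTr p F (X.2.2.1 * j + τ * X.2.2.2.2 + μ * X.2.1)
    else 0

lemma zetaTr_add (p : ℕ) (hp : p.Prime) (F : Type) [Field F] [Fintype F] [Algebra (ZMod p) F]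
    (a b : F) : zetaTr p F (a + b) = zetaTr p F a * zetaTr p F b := by
  have : NeZero p := ⟨hp.ne_zero⟩
  have key : ∀ c : F, zetaTr p F c = (ZMod.toCircle (Algebra.trace (ZMod p) F c) : ℂ) := by
    intro c
    rw [ZMod.toCircle_apply, zetaTr]
  rw [key, key, key, map_add, AddChar.map_add_eq_mul, Circle.coe_mul]

/-- Let `q = p^e` be an odd prime power and `τ, μ ∈ F_q` with `τ ≠ 0`.  Then
`N_{τ,μ}(X·Y) = N_{τ,μ}(X)·N_{τ,μ}(Y)` for all `X, Y ∈ G`; i.e. `N_{τ,μ}` is a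
`q`-dimensional complex matrix representation of `G`. -/
theorem stmt_8 (p e : ℕ) (hp : p.Prime) (hodd : p ≠ 2) (he : 0 < e)
    (F : Type) [Field F] [Fintype F] [DecidableEq F] [Algebra (ZMod p) F]
    (hcard : Fintype.card F = p ^ e)
    (τ μ : F) (hτ : τ ≠ 0) :
    ∀ X Y : Tup F, Nrep p F τ μ (gmul X Y) = Nrep p F τ μ X * Nrep p F τ μ Y := by
  intro X Y
  ext j k
  rw [Matrix.mul_apply, Finset.sum_eq_single (2 * X.1 * τ + j)]
  · simp only [Nrep, Matrix.of_apply, if_true]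
    have h : 2 * (gmul X Y).1 * τ + j = 2 * Y.1 * τ + (2 * X.1 * τ + j) := by
      simp only [gmul]
      ring
    by_cases hk : k = 2 * Y.1 * τ + (2 * X.1 * τ + j)
    · rw [if_pos (hk.trans h.symm), if_pos hk, ← zetaTr_add p hp]
      congr 1
      simp only [gmul]
      ring
    · rw [if_neg hk, if_neg (fun hk' => hk (hk'.trans h)), mul_zero]
  · intro b _ hb
    simp [Nrep, hb]
  · intro h
    exact absurd (Finset.mem_univ _) h
end

section
/- Let q = p^e be an odd prime power. For τ, μ ∈ F_q with τ ≠ 0 define φ_{τ,μ}(X) = Tr(N_{τ,μ}(X)), and for α, β, γ ∈ F_q with α ≠ 0 define ψ_{α,β,γ}(X) = Tr(M_{α,β,γ}(X)). Then: (i) (1/q⁵)·∑_{X ∈ F_q^5} φ_{τ,μ}(X)·conj(φ_{τ',μ'}(X)) equals 1 if (τ,μ) = (τ',μ') and 0 otherwise, for all τ, τ' ≠ 0 and μ, μ' ∈ F_q; and (ii) (1/q⁵)·∑_{X ∈ F_q^5} ψ_{α,β,γ}(X)·conj(φ_{τ,μ}(X)) = 0 for all α ≠ 0, τ ≠ 0,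 and β, γ, μ ∈ F_q. -/
/-- The `q×q` complex matrix `M_{α,β,γ}(X)`, indexed by `F_q`, whose `(j,k)` entry is
`ζ^{tr((x₂ + (β/α)x₃)·j + α·x₄ + β·x₅ + γ·x₃)}` if `k = 2x₁α + j`, and `0` otherwise. -/
noncomputable def Mrep (p : ℕ) (F : Type) [Field F] [Fintype F] [DecidableEq F]
    [Algebra (ZMod p) F] (α β γ : F) (X : Tup F) : Matrix F F ℂ :=
  Matrix.of fun j k =>
    if k = 2 * X.1 * α + j then
      zetaTr p F ((X.2.1 + (β / α) * X.2.2.1) * j +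
        α * X.2.2.2.1 + β * X.2.2.2.2 + γ * X.2.2.1)
    else 0

/-- The character `ψ_{α,β,γ}(X) = Tr(M_{α,β,γ}(X))`. -/
noncomputable def psi (p : ℕ) (F : Type) [Field F] [Fintype F] [DecidableEq F]
    [Algebra (ZMod p) F] (α β γ : F) (X : Tup F) : ℂ :=
  Matrix.trace (Mrep p F α β γ X)

/-- The character `φ_{τ,μ}(X) = Tr(N_{τ,μ}(X))`. -/
noncomputable def phi (p : ℕ) (F : Type) [Field F] [Fintype F] [DecidableEq F]
    [Algebra (ZMod p) F] (τ μ : F) (X : Tup F) : ℂ :=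
  Matrix.trace (Nrep p F τ μ X)

theorem sum_five (F : Type) [Fintype F] (f g h k : F → ℂ) :
    ∑ x₁, ∑ x₂, ∑ x₃, ∑ _x₄ : F, ∑ x₅, f x₁ * (g x₂ * (h x₃ * k x₅)) =
      (∑ x, f x) * ((∑ x, g x) * ((∑ x, h x) * ((Fintype.card F : ℂ) * ∑ x, k x))) := by
  simp only [← Finset.mul_sum, Finset.sum_const, Finset.card_univ, nsmul_eq_mul]
  simp only [Finset.sum_mul]

theorem exists_zetaChar (p : ℕ) (hp : p.Prime) (F : Type) [Field F] [Fintype F]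
    [Algebra (ZMod p) F] :
    ∃ χ : AddChar F ℂ, χ.IsPrimitive ∧ ∀ c, zetaTr p F c = χ c := by
  have : Fact p.Prime := ⟨hp⟩
  have : NeZero p := ⟨hp.ne_zero⟩
  refine ⟨(ZMod.stdAddChar (N := p)).compAddMonoidHom
    (Algebra.trace (ZMod p) F).toAddMonoidHom, ?_, ?_⟩
  · apply AddChar.IsPrimitive.of_ne_one
    intro h
    obtain ⟨a, ha⟩ := Algebra.trace_surjective (ZMod p) F 1
    have h1 := DFunLike.congr_fun h a
    simp only [AddChar.compAddMonoidHom_apply, LinearMap.toAddMonoidHom_coe, ha,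
      AddChar.one_apply] at h1
    rw [← AddChar.map_zero_eq_one (ZMod.stdAddChar (N := p))] at h1
    exact one_ne_zero (ZMod.injective_stdAddChar h1)
  · intro c
    simp only [AddChar.compAddMonoidHom_apply, LinearMap.toAddMonoidHom_coe,
      ZMod.stdAddChar_apply, ZMod.toCircle_apply, zetaTr]

theorem phi_eq (p : ℕ) (F : Type) [Field F] [Fintype F] [DecidableEq F]
    [Algebra (ZMod p) F] (h2 : (2 : F) ≠ 0) (χ : AddChar F ℂ) (hχ : χ.IsPrimitive)
    (hz : ∀ c, zetaTr p F c = χ c) (τ μ : F) (hτ : τ ≠ 0) (x₁ x₂ x₃ x₄ x₅ : F) :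
    phi p F τ μ (x₁, x₂, x₃, x₄, x₅) =
      (if x₁ = 0 then 1 else 0) * (χ (x₂ * μ) * ((if x₃ = 0 then (Fintype.card F : ℂ) else 0)
        * χ (x₅ * τ))) := by
  have hs := AddChar.sum_mulShift (R := F) (R' := ℂ) x₃ hχ
  simp only [phi, Nrep, Matrix.trace, Matrix.diag, Matrix.of_apply, hz]
  by_cases h : x₁ = 0
  · subst h
    simp only [mul_zero, zero_mul, zero_add, if_true, one_mul]
    have : ∀ j, χ (x₃ * j + τ * x₅ + μ * x₂) = χ (j * x₃) * (χ (x₅ * τ) * χ (x₂ * μ)) := by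
      intro j
      rw [← AddChar.map_add_eq_mul, ← AddChar.map_add_eq_mul]
      congr 1; ring
    simp only [this, ← Finset.sum_mul, hs]
    push_cast
    ring
  · simp [h, h2, hτ]

theorem psi_eq (p : ℕ) (F : Type) [Field F] [Fintype F] [DecidableEq F]
    [Algebra (ZMod p) F] (χ : AddChar F ℂ)
    (hz : ∀ c, zetaTr p F c = χ c) (α β γ : F) (x₁ x₂ x₃ x₄ x₅ : F) :
    psi p F α β γ (x₁, x₂, x₃, x₄, x₅) = χ (x₄ * α) * psi p F α β γ (x₁, x₂, x₃, 0, x₅) := by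
  simp only [psi, Mrep, Matrix.trace, Matrix.diag, Matrix.of_apply, hz, Finset.mul_sum]
  refine Finset.sum_congr rfl fun j _ => ?_
  split_ifs
  · rw [← AddChar.map_add_eq_mul]
    congr 1; ring
  · simp

/-- Let `q = p^e` be an odd prime power.  Then (i) for all `τ, τ' ≠ 0` and `μ, μ' ∈ F_q`,
`(1/q⁵)·∑_{X ∈ F_q^5} φ_{τ,μ}(X)·conj(φ_{τ',μ'}(X))` equals `1` if `(τ,μ) = (τ',μ')` and
`0` otherwise; and (ii) for all `α ≠ 0`, `τ ≠ 0`, and `β, γ, μ ∈ F_q`,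
`(1/q⁵)·∑_{X ∈ F_q^5} ψ_{α,β,γ}(X)·conj(φ_{τ,μ}(X)) = 0`. -/
theorem stmt_10 (p e : ℕ) (hp : p.Prime) (hodd : p ≠ 2) (he : 0 < e)
    (F : Type) [Field F] [Fintype F] [DecidableEq F] [Algebra (ZMod p) F]
    (hcard : Fintype.card F = p ^ e) :
    (∀ τ τ' μ μ' : F, τ ≠ 0 → τ' ≠ 0 →
      (1 / (Fintype.card F : ℂ) ^ 5) *
        ∑ X : Tup F, phi p F τ μ X * (starRingEnd ℂ) (phi p F τ' μ' X) =
        if (τ, μ) = (τ', μ') then 1 else 0) ∧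
    (∀ α β γ τ μ : F, α ≠ 0 → τ ≠ 0 →
      (1 / (Fintype.card F : ℂ) ^ 5) *
        ∑ X : Tup F, psi p F α β γ X * (starRingEnd ℂ) (phi p F τ μ X) = 0) := by
  have : Fact p.Prime := ⟨hp⟩
  obtain ⟨χ, hχ, hz⟩ := exists_zetaChar p hp F
  have hq : (Fintype.card F : ℂ) ≠ 0 := by
    exact_mod_cast Fintype.card_ne_zero
  have : CharP F p := charP_of_injective_algebraMap (algebraMap (ZMod p) F).injective p
  have h2 : (2 : F) ≠ 0 := Ring.two_ne_zero (by rwa [ringChar.eq F p])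
  refine ⟨?_, ?_⟩
  · intro τ τ' μ μ' hτ hτ'
    have hs (a b : F) : ∑ x, χ (x * a) * (starRingEnd ℂ) (χ (x * b)) =
        if a = b then (Fintype.card F : ℂ) else 0 := by
      have := AddChar.sum_mulShift (R := F) (R' := ℂ) (a - b) hχ
      simp only [sub_eq_zero] at this
      push_cast at this
      rw [← this]
      refine Finset.sum_congr rfl fun x _ => ?_
      rw [← AddChar.map_neg_eq_conj, ← AddChar.map_add_eq_mul]
      congr 1; ring
    have key : ∀ x₁ x₂ x₃ x₄ x₅ : F, phi p F τ μ (x₁, x₂, x₃, x₄, x₅) *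
        (starRingEnd ℂ) (phi p F τ' μ' (x₁, x₂, x₃, x₄, x₅)) =
        (if x₁ = 0 then 1 else 0) * ((χ (x₂ * μ) * (starRingEnd ℂ) (χ (x₂ * μ'))) *
          ((if x₃ = 0 then (Fintype.card F : ℂ) ^ 2 else 0) *
          (χ (x₅ * τ) * (starRingEnd ℂ) (χ (x₅ * τ'))))) := by
      intro x₁ x₂ x₃ x₄ x₅
      rw [phi_eq p F h2 χ hχ hz τ μ hτ, phi_eq p F h2 χ hχ hz τ' μ' hτ']
      split_ifs <;> simp
      ring
    simp only [Fintype.sum_prod_type, key]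
    rw [sum_five F (fun x => if x = 0 then 1 else 0)
      (fun x => χ (x * μ) * (starRingEnd ℂ) (χ (x * μ')))
      (fun x => if x = 0 then (Fintype.card F : ℂ) ^ 2 else 0)
      (fun x => χ (x * τ) * (starRingEnd ℂ) (χ (x * τ'))), hs, hs]
    simp only [Finset.sum_ite_eq', Finset.mem_univ, if_true, Prod.mk.injEq]
    by_cases h1 : τ = τ' <;> by_cases h3 : μ = μ' <;> simp [h1, h3]
    field_simp
  · intro α β γ τ μ hα hτ
    have hs := AddChar.sum_mulShift (R := F) (R' := ℂ) α hχ
    rw [if_neg hα] at hs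
    have key : ∀ x₁ x₂ x₃ x₄ x₅ : F, psi p F α β γ (x₁, x₂, x₃, x₄, x₅) *
        (starRingEnd ℂ) (phi p F τ μ (x₁, x₂, x₃, x₄, x₅)) =
        χ (x₄ * α) * (psi p F α β γ (x₁, x₂, x₃, 0, x₅) *
        (starRingEnd ℂ) (phi p F τ μ (x₁, x₂, x₃, 0, x₅))) := by
      intro x₁ x₂ x₃ x₄ x₅
      rw [psi_eq p F χ hz, mul_assoc]
      rfl
    simp only [Fintype.sum_prod_type]
    rw [Finset.sum_eq_zero, mul_zero]
    intro x₁ _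
    refine Finset.sum_eq_zero fun x₂ _ => Finset.sum_eq_zero fun x₃ _ => ?_
    rw [Finset.sum_congr rfl fun x₄ _ => Finset.sum_congr rfl fun x₅ _ => key x₁ x₂ x₃ x₄ x₅]
    rw [← Finset.sum_mul_sum, hs]
    simp
end
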